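/- arXiv:2305.05979 — 6 statements merged into one kernel-verified Lean document; each statement's English description precedes it below -/
import Mathlib

section
/- For every natural number n and every real ρ, the Bessel function J_n satisfies Bessel's differential equation: ρ² · J_n''(ρ) + ρ · J_n'(ρ) + (ρ² − n²) · J_n(ρ) = 0. -/
/-- The Bessel function of the first kind of (natural) order `n`. -/
noncomputable def besselJ (n : ℕ) (ρ : ℝ) : ℝ :=
  ∑' m : ℕ, ((-1 : ℝ) ^ m / (m.factorial * (n + m).factorial)) * (ρ / 2) ^ (n + 2 * m)

def EntireCoeff (c : ℕ → ℝ) (k : ℕ → ℕ) : Prop :=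
  ∀ R : ℝ, 1 ≤ R → Summable fun m => |c m| * R ^ (k m)

lemma EntireCoeff.summable {c : ℕ → ℝ} {k : ℕ → ℕ} (h : EntireCoeff c k) (x : ℝ) :
    Summable fun m => c m * x ^ (k m) := by
  refine Summable.of_norm_bounded (h (max 1 |x|) (le_max_left _ _)) fun m => ?_
  rw [Real.norm_eq_abs, abs_mul, abs_pow]
  gcongr
  exact le_max_right _ _

lemma EntireCoeff.der {c : ℕ → ℝ} {k : ℕ → ℕ} (h : EntireCoeff c k) :
    EntireCoeff (fun m => c m * (k m : ℝ)) (fun m => k m - 1) := by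
  intro R hR
  refine Summable.of_nonneg_of_le (fun m => by positivity) (fun m => ?_)
    (h (2 * R) (by linarith))
  rw [abs_mul, mul_pow, mul_assoc]
  have h1 : |(k m : ℝ)| ≤ 2 ^ (k m) := by
    rw [Nat.abs_cast]
    exact_mod_cast (Nat.lt_two_pow_self).le
  have h2 : R ^ (k m - 1) ≤ R ^ (k m) := pow_le_pow_right₀ hR (Nat.sub_le _ _)
  gcongr

lemma EntireCoeff.hasDerivAt {c : ℕ → ℝ} {k : ℕ → ℕ} (h : EntireCoeff c k) (x : ℝ) :
    HasDerivAt (fun x => ∑' m, c m * x ^ (k m))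
      (∑' m, (c m * (k m : ℝ)) * x ^ (k m - 1)) x := by
  have hx : x ∈ Metric.ball (0 : ℝ) (|x| + 1) := by simp
  refine hasDerivAt_tsum_of_isPreconnected (t := Metric.ball (0 : ℝ) (|x| + 1))
    (g := fun m x => c m * x ^ (k m)) (g' := fun m x => (c m * (k m : ℝ)) * x ^ (k m - 1))
    (h.der (|x| + 1) (by linarith [abs_nonneg x])) Metric.isOpen_ball
    (convex_ball _ _).isPreconnected (fun m y _ => ?_) (fun m y hy => ?_) hx (h.summable x) hx
  · have := (hasDerivAt_pow (k m) y).const_mul (c m)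
    rw [← mul_assoc] at this
    exact this
  · rw [Real.norm_eq_abs, abs_mul, abs_pow]
    have : |y| ≤ |x| + 1 := by
      rw [mem_ball_zero_iff, Real.norm_eq_abs] at hy
      exact hy.le
    gcongr

noncomputable def besselC (n m : ℕ) : ℝ :=
  (-1 : ℝ) ^ m / (m.factorial * (n + m).factorial) / 2 ^ (n + 2 * m)

lemma besselC_entire (n : ℕ) : EntireCoeff (besselC n) (fun m => n + 2 * m) := by
  intro R hR
  refine Summable.of_nonneg_of_le (fun m => by positivity) (fun m => ?_)
    ((Real.summable_pow_div_factorial (R ^ 2)).mul_left (R ^ n))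
  have h1 : |besselC n m| ≤ 1 / m.factorial := by
    rw [besselC, abs_div, abs_div, abs_pow, abs_neg, abs_one, one_pow, abs_of_nonneg (by positivity),
      abs_of_nonneg (by positivity), div_div]
    have ha : (1 : ℝ) ≤ (n + m).factorial := by exact_mod_cast Nat.succ_le_of_lt (Nat.factorial_pos _)
    have hb : (1 : ℝ) ≤ 2 ^ (n + 2 * m) := one_le_pow₀ (by norm_num)
    apply one_div_le_one_div_of_le (by positivity)
    rw [mul_assoc]
    exact le_mul_of_one_le_right (by positivity) (one_le_mul_of_one_le_of_one_le ha hb)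
  calc |besselC n m| * R ^ (n + 2 * m) ≤ 1 / m.factorial * R ^ (n + 2 * m) := by gcongr
    _ = _ := by rw [pow_add, pow_mul]; ring

lemma besselC_succ (n m : ℕ) :
    besselC n (m + 1) * (4 * ((m : ℝ) + 1) * (n + m + 1)) = - besselC n m := by
  have e : n + 2 * (m + 1) = n + 2 * m + 2 := by ring
  unfold besselC
  rw [e, ← add_assoc, Nat.factorial_succ, Nat.factorial_succ, pow_succ, pow_add]
  push_cast
  have : (m : ℝ) + 1 ≠ 0 := by positivity
  have : (n : ℝ) + m + 1 ≠ 0 := by positivity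
  field_simp
  norm_num

/-- The Bessel function `J_n` satisfies Bessel's differential equation
`ρ² J_n'' + ρ J_n' + (ρ² − n²) J_n = 0` for every real `ρ`. -/
theorem besselJ_ode (n : ℕ) (ρ : ℝ) :
    ρ ^ 2 * deriv (deriv (besselJ n)) ρ + ρ * deriv (besselJ n) ρ
      + (ρ ^ 2 - (n : ℝ) ^ 2) * besselJ n ρ = 0 := by
  have h := besselC_entire n
  have e0 : besselJ n = fun x => ∑' m, besselC n m * x ^ (n + 2 * m) := by
    funext x
    unfold besselJ besselC
    refine tsum_congr fun m => ?_
    rw [div_pow]; ring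
  have e1 := funext fun x => (h.hasDerivAt x).deriv
  have e2 := (h.der.hasDerivAt ρ).deriv
  have s0 := h.summable ρ
  have s1 := h.der.summable ρ
  have s2 := h.der.der.summable ρ
  rw [e0, e1, e2]
  beta_reduce at s0 s1 s2 ⊢
  have key := ((s2.hasSum.mul_left (ρ ^ 2)).add (s1.hasSum.mul_left ρ)).add
    (s0.hasSum.mul_left (-(n : ℝ) ^ 2))
  have hd : ∀ m : ℕ, ρ ^ 2 * (besselC n m * ((n + 2 * m : ℕ) : ℝ) * ((n + 2 * m - 1 : ℕ) : ℝ)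
        * ρ ^ (n + 2 * m - 1 - 1)) + ρ * (besselC n m * ((n + 2 * m : ℕ) : ℝ)
        * ρ ^ (n + 2 * m - 1)) + -(n : ℝ) ^ 2 * (besselC n m * ρ ^ (n + 2 * m))
      = besselC n m * (4 * m * (n + m)) * ρ ^ (n + 2 * m) := by
    intro m
    have hk : (4 * m * (n + m) : ℝ) = ((n + 2 * m : ℕ) : ℝ) ^ 2 - (n : ℝ) ^ 2 := by
      push_cast; ring
    rw [hk]
    generalize n + 2 * m = k
    rcases k with _ | _ | k
    · simp; ring
    · simp; ring
    · simp only [Nat.add_sub_cancel]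
      push_cast
      ring
  simp only [hd] at key
  have key2 := (hasSum_nat_add_iff' 1).mpr key
  have hs : ∀ m : ℕ, besselC n (m + 1) * (4 * ((m + 1 : ℕ) : ℝ) * (n + ((m + 1 : ℕ) : ℝ)))
      * ρ ^ (n + 2 * (m + 1)) = -ρ ^ 2 * (besselC n m * ρ ^ (n + 2 * m)) := by
    intro m
    have := besselC_succ n m
    push_cast
    rw [← add_assoc (n : ℝ), this]
    ring
  simp only [hs] at key2
  have := key2.unique (s0.hasSum.mul_left (-ρ ^ 2))
  simp only [Finset.range_one, Finset.sum_singleton, Nat.cast_zero, mul_zero, zero_mul, sub_zero] at this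
  linarith
end

section
/- For every natural number n, the set { ρ ∈ ℝ : ρ > 0 and J_n'(ρ) = 0 } of positive critical points of the Bessel function J_n is infinite. Consequently these zeros of J_n' can be enumerated as an increasing sequence α_{n1} < α_{n2} < α_{n3} < ⋯. -/
open Filter Topology

noncomputable def bC (n m : ℕ) : ℝ := (-1 : ℝ) ^ m / (m.factorial * (n + m).factorial)

noncomputable def bG (n : ℕ) (x : ℝ) : ℝ := ∑' m : ℕ, bC n m * x ^ m

theorem bC_norm_le (n m : ℕ) : ‖bC n m‖ ≤ 1 / (m.factorial : ℝ) := by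
  unfold bC
  rw [norm_div, norm_pow, norm_neg, norm_one, one_pow]
  have h1 : (0 : ℝ) < m.factorial := by exact_mod_cast Nat.factorial_pos m
  have h2 : (1 : ℝ) ≤ (n + m).factorial := by exact_mod_cast Nat.factorial_pos (n + m)
  rw [Real.norm_of_nonneg (by positivity)]
  apply one_div_le_one_div_of_le h1
  nlinarith

theorem bG_summable (n : ℕ) (x : ℝ) : Summable (fun m => bC n m * x ^ m) := by
  refine Summable.of_norm_bounded (Real.summable_pow_div_factorial |x|) fun m => ?_
  rw [norm_mul, norm_pow, Real.norm_eq_abs x]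
  calc _ ≤ 1 / (m.factorial : ℝ) * |x| ^ m := by gcongr; exact bC_norm_le n m
    _ = _ := by ring

theorem bC_succ (n m : ℕ) : bC n (m + 1) * ((m : ℝ) + 1) = - bC (n + 1) m := by
  unfold bC
  have h1 : (m.factorial : ℝ) ≠ 0 := by exact_mod_cast (Nat.factorial_pos m).ne'
  have h2 : ((n + 1 + m).factorial : ℝ) ≠ 0 := by exact_mod_cast (Nat.factorial_pos _).ne'
  rw [show n + (m + 1) = n + 1 + m by ring, Nat.factorial_succ m]
  have h3 : (m : ℝ) + 1 ≠ 0 := by positivity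
  push_cast
  field_simp
  ring

theorem bG_hasDerivAt (n : ℕ) (x : ℝ) : HasDerivAt (bG n) (- bG (n + 1) x) x := by
  have key : ∀ (m : ℕ) (y : ℝ), bC n (m + 1) * (((m + 1 : ℕ) : ℝ) * y ^ (m + 1 - 1))
      = - (bC (n + 1) m * y ^ m) := by
    intro m y
    have := bC_succ n m
    push_cast
    rw [← mul_assoc, this]; ring
  have h : HasDerivAt (fun z => ∑' m : ℕ, bC n m * z ^ m)
      (∑' m : ℕ, bC n m * ((m : ℝ) * x ^ (m - 1))) x := by
    refine hasDerivAt_tsum_of_isPreconnected (g := fun m z => bC n m * z ^ m)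
      (g' := fun m z => bC n m * ((m : ℝ) * z ^ (m - 1)))
      (u := fun m => ‖bC n m‖ * ((m : ℝ) * (|x| + 1) ^ (m - 1)))
      (t := Metric.ball (0 : ℝ) (|x| + 1)) (y₀ := x) ?_ Metric.isOpen_ball
      (convex_ball (0 : ℝ) (|x| + 1)).isPreconnected ?_ ?_ ?_ (bG_summable n x) ?_
    · rw [← summable_nat_add_iff 1]
      refine ((bG_summable (n + 1) (|x| + 1)).norm).congr fun m => ?_
      have hn : (0 : ℝ) ≤ ((m + 1 : ℕ) : ℝ) * (|x| + 1) ^ (m + 1 - 1) := by positivity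
      rw [← norm_neg, ← key m (|x| + 1), norm_mul, Real.norm_of_nonneg hn]
    · intro m y _
      exact (hasDerivAt_pow m y).const_mul _
    · intro m y hy
      rw [mem_ball_zero_iff, Real.norm_eq_abs] at hy
      rw [norm_mul, norm_mul, norm_pow, Real.norm_natCast, Real.norm_eq_abs y]
      gcongr
    · simp
    · simp
  have hs : Summable (fun m : ℕ => bC n m * ((m : ℝ) * x ^ (m - 1))) := by
    rw [← summable_nat_add_iff 1]
    exact ((bG_summable (n + 1) x).neg).congr fun m => (key m x).symm
  have h' : HasDerivAt (bG n) _ x := h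
  convert h' using 1
  rw [hs.tsum_eq_zero_add]
  simp only [key]
  rw [tsum_neg]
  simp [bG]

theorem bG_rec (n : ℕ) (x : ℝ) : x * bG (n + 2) x = (n + 1) * bG (n + 1) x - bG n x := by
  have h : ∀ m, ((n : ℝ) + 1) * (bC (n + 1) m * x ^ m) - bC n m * x ^ m
      = - (m : ℝ) * bC (n + 1) m * x ^ m := by
    intro m
    have : bC n m = bC (n + 1) m * (n + m + 1) := by
      unfold bC
      have h1 : (m.factorial : ℝ) ≠ 0 := by exact_mod_cast (Nat.factorial_pos m).ne'
      have h2 : ((n + m).factorial : ℝ) ≠ 0 := by exact_mod_cast (Nat.factorial_pos _).ne'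
      rw [show n + 1 + m = (n + m) + 1 by ring, Nat.factorial_succ (n + m)]
      have h3 : (n : ℝ) + m + 1 ≠ 0 := by positivity
      push_cast
      field_simp
    rw [this]; ring
  have hs1 := (bG_summable (n + 1) x).mul_left ((n : ℝ) + 1)
  have hs2 := bG_summable n x
  have hs := hs1.sub hs2
  unfold bG
  rw [← tsum_mul_left, ← tsum_mul_left, ← hs1.tsum_sub hs2, hs.tsum_eq_zero_add]
  simp only [h]
  simp only [Nat.cast_zero, neg_zero, zero_mul, zero_add]
  refine tsum_congr fun m => ?_
  have := bC_succ (n + 1) m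
  push_cast
  have e : -((m : ℝ) + 1) * bC (n + 1) (m + 1) = bC (n + 1 + 1) m := by linarith
  rw [e]; ring

theorem bG_analytic (n : ℕ) : AnalyticOnNhd ℝ (bG n) Set.univ := by
  set p := FormalMultilinearSeries.ofScalars ℝ (bC n) with hp
  have hr : p.radius = ⊤ := by
    refine ENNReal.eq_top_of_forall_nnreal_le fun r => ?_
    refine p.le_radius_of_summable ?_
    refine ((bG_summable n r).norm).congr fun m => ?_
    rw [hp, FormalMultilinearSeries.ofScalars_norm, norm_mul, norm_pow, NNReal.norm_eq]
  have h := p.hasFPowerSeriesOnBall (by rw [hr]; simp)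
  have he : p.sum = bG n := by
    have := FormalMultilinearSeries.ofScalarsSum_eq_tsum (E := ℝ) (bC n)
    funext x
    have := congrFun this x
    simpa [FormalMultilinearSeries.ofScalarsSum, bG, smul_eq_mul, hp] using this
  rw [he, hr] at h
  intro x _
  exact h.analyticAt_of_mem (by simp)

theorem besselJ_eq (n : ℕ) : besselJ n = fun ρ => (ρ / 2) ^ n * bG n (ρ ^ 2 / 4) := by
  funext ρ
  unfold besselJ bG
  rw [← tsum_mul_left]
  refine tsum_congr fun m => ?_
  rw [pow_add, pow_mul, show (ρ / 2) ^ 2 = ρ ^ 2 / 4 by ring]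
  unfold bC
  ring

theorem bH_hasDerivAt (k n : ℕ) {ρ : ℝ} (hρ : 0 < ρ) :
    HasDerivAt (fun ρ : ℝ => (ρ / 2) ^ k * bG n (ρ ^ 2 / 4))
      ((k * ((ρ / 2) ^ k * bG n (ρ ^ 2 / 4)) - 2 * ((ρ / 2) ^ (k + 2) * bG (n + 1) (ρ ^ 2 / 4))) / ρ)
      ρ := by
  have h1 : HasDerivAt (fun ρ : ℝ => (ρ / 2) ^ k) (k * (ρ / 2) ^ (k - 1) * (1 / 2)) ρ :=
    ((hasDerivAt_id ρ).div_const 2).pow k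
  have h2 : HasDerivAt (fun ρ : ℝ => ρ ^ 2 / 4) (2 * ρ / 4) ρ := by
    simpa using (hasDerivAt_pow 2 ρ).div_const 4
  have h3 : HasDerivAt (fun ρ : ℝ => bG n (ρ ^ 2 / 4)) (- bG (n + 1) (ρ ^ 2 / 4) * (2 * ρ / 4)) ρ :=
    HasDerivAt.comp (h₂ := bG n) ρ (bG_hasDerivAt n (ρ ^ 2 / 4)) h2
  have h4 : HasDerivAt (fun ρ : ℝ => (ρ / 2) ^ k * bG n (ρ ^ 2 / 4)) _ ρ := h1.mul h3
  convert h4 using 1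
  rcases k with _ | k
  · simp; field_simp; ring
  · rw [show k + 1 - 1 = k by omega]
    push_cast
    field_simp
    ring

noncomputable def bP (n : ℕ) (ρ : ℝ) : ℝ :=
  n * besselJ n ρ - 2 * ((ρ / 2) ^ (n + 2) * bG (n + 1) (ρ ^ 2 / 4))

theorem besselJ_hasDerivAt (n : ℕ) {ρ : ℝ} (hρ : 0 < ρ) :
    HasDerivAt (besselJ n) (bP n ρ / ρ) ρ := by
  have := bH_hasDerivAt n n hρ
  unfold bP
  rw [besselJ_eq]
  exact this

theorem bP_hasDerivAt (n : ℕ) {ρ : ℝ} (hρ : 0 < ρ) :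
    HasDerivAt (bP n) (((n : ℝ) ^ 2 - ρ ^ 2) * besselJ n ρ / ρ) ρ := by
  have h1 := (besselJ_hasDerivAt n hρ).const_mul (n : ℝ)
  have h2 := (bH_hasDerivAt (n + 2) (n + 1) hρ).const_mul 2
  have h := h1.sub h2
  have hrec := bG_rec n (ρ ^ 2 / 4)
  have e : HasDerivAt (bP n) _ ρ := h
  convert e using 1
  unfold bP
  rw [besselJ_eq]
  simp only
  rw [show n + 2 + 2 = (n + 2) + 2 by rfl, show n + 1 + 1 = n + 2 by rfl, pow_add _ (n + 2) 2,
    show (ρ / 2) ^ 2 = ρ ^ 2 / 4 by ring, mul_assoc ((ρ / 2) ^ (n + 2)), hrec, pow_add _ n 2]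
  push_cast
  field_simp
  ring

theorem osc (N : ℝ) (hN : 0 ≤ N) (y p : ℝ → ℝ)
    (hy : ∀ ρ, 0 < ρ → HasDerivAt y (p ρ / ρ) ρ)
    (hp : ∀ ρ, 0 < ρ → HasDerivAt p ((N - ρ ^ 2) * y ρ / ρ) ρ)
    (R : ℝ) (hpos : ∀ ρ, R ≤ ρ → 0 < p ρ) : False := by
  by_cases hc : ∃ a, R ≤ a ∧ 0 < a ∧ N + 1 ≤ a ∧ 0 < y a
  · obtain ⟨a, haR, ha0, haN, hya⟩ := hc
    have hmono : MonotoneOn y (Set.Ici a) := by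
      refine monotoneOn_of_deriv_nonneg (convex_Ici a)
        (fun x hx => (hy x (ha0.trans_le hx)).continuousAt.continuousWithinAt)
        (fun x hx => ?_) (fun x hx => ?_) <;> rw [interior_Ici] at hx <;>
        have hx' : a < x := hx
      · exact (hy x (ha0.trans hx')).differentiableAt.differentiableWithinAt
      · rw [(hy x (ha0.trans hx')).deriv]
        exact div_nonneg (hpos x (haR.trans hx'.le)).le (ha0.trans hx').le
    -- p + c * (ρ^2/2 - N ρ) antitone
    have hd : ∀ x, 0 < x → HasDerivAt (fun x => p x + y a * (x ^ 2 / 2 - N * x))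
        ((N - x ^ 2) * y x / x + y a * (2 * x / 2 - N)) x := by
      intro x hx
      refine (hp x hx).add (HasDerivAt.const_mul _ ?_)
      refine HasDerivAt.sub ?_ ?_
      · simpa using (hasDerivAt_pow 2 x).div_const 2
      · simpa using (hasDerivAt_id x).const_mul N
    have hanti : AntitoneOn (fun x => p x + y a * (x ^ 2 / 2 - N * x)) (Set.Ici a) := by
      refine antitoneOn_of_deriv_nonpos (convex_Ici a)
        (fun x hx => (hd x (ha0.trans_le hx)).continuousAt.continuousWithinAt)
        (fun x hx => ?_) (fun x hx => ?_) <;> rw [interior_Ici] at hx <;>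
        have hx' : a < x := hx
      · exact (hd x (ha0.trans hx')).differentiableAt.differentiableWithinAt
      · rw [(hd x (ha0.trans hx')).deriv]
        have hx0 := ha0.trans hx'
        have hyx : y a ≤ y x := hmono Set.self_mem_Ici hx'.le hx'.le
        have h1 : (N - x ^ 2) * y x / x ≤ (N - x) * y a := by
          rw [div_le_iff₀ hx0]
          have h3 : N ≤ x * N := by nlinarith
          have h4 : 0 ≤ x ^ 2 - N := by nlinarith
          have h5 : (x ^ 2 - N) * y a ≤ (x ^ 2 - N) * y x := by gcongr
          have h6 : 0 ≤ (x * N - N) * y a := mul_nonneg (by linarith) hya.le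
          nlinarith
        nlinarith
    have ht : Tendsto (fun x : ℝ => y a * (x ^ 2 / 2 - N * x)) atTop atTop := by
      refine Tendsto.const_mul_atTop hya ?_
      have : (fun x : ℝ => x ^ 2 / 2 - N * x) = fun x => x * (x * (1 / 2) + (- N)) := by
        funext x; ring
      rw [this]
      exact tendsto_id.atTop_mul_atTop₀
        (tendsto_atTop_add_const_right _ _ (tendsto_id.atTop_mul_const (by norm_num)))
    obtain ⟨x, hx1, hx2⟩ := ((ht.eventually_gt_atTop
      (p a + y a * (a ^ 2 / 2 - N * a))).and (eventually_ge_atTop a)).exists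
    have := hanti Set.self_mem_Ici hx2 hx2
    have := hpos x (haR.trans hx2)
    simp only at *
    linarith
  · push Not at hc
    set a := max R (N + 1) with ha
    have haR : R ≤ a := le_max_left _ _
    have haN : N + 1 ≤ a := le_max_right _ _
    have ha0 : 0 < a := by linarith
    have hneg : ∀ x, a ≤ x → y x ≤ 0 := fun x hx =>
      hc x (haR.trans hx) (ha0.trans_le hx) (haN.trans hx)
    have hmono : MonotoneOn p (Set.Ici a) := by
      refine monotoneOn_of_deriv_nonneg (convex_Ici a)
        (fun x hx => (hp x (ha0.trans_le hx)).continuousAt.continuousWithinAt)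
        (fun x hx => ?_) (fun x hx => ?_) <;> rw [interior_Ici] at hx <;>
        have hx' : a < x := hx
      · exact (hp x (ha0.trans hx')).differentiableAt.differentiableWithinAt
      · rw [(hp x (ha0.trans hx')).deriv]
        refine div_nonneg (mul_nonneg_of_nonpos_of_nonpos ?_ (hneg x hx'.le)) (ha0.trans hx').le
        nlinarith
    have hpa := hpos a haR
    have hd : ∀ x, 0 < x → HasDerivAt (fun x => y x - p a * Real.log x)
        (p x / x - p a * x⁻¹) x := fun x hx =>
      (hy x hx).sub ((Real.hasDerivAt_log hx.ne').const_mul _)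
    have hm2 : MonotoneOn (fun x => y x - p a * Real.log x) (Set.Ici a) := by
      refine monotoneOn_of_deriv_nonneg (convex_Ici a)
        (fun x hx => (hd x (ha0.trans_le hx)).continuousAt.continuousWithinAt)
        (fun x hx => ?_) (fun x hx => ?_) <;> rw [interior_Ici] at hx <;>
        have hx' : a < x := hx
      · exact (hd x (ha0.trans hx')).differentiableAt.differentiableWithinAt
      · rw [(hd x (ha0.trans hx')).deriv]
        have hx0 := ha0.trans hx'
        have : p a ≤ p x := hmono Set.self_mem_Ici hx'.le hx'.le
        rw [div_eq_mul_inv, ← sub_mul]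
        exact mul_nonneg (by linarith) (inv_pos.2 hx0).le
    have ht := Real.tendsto_log_atTop.const_mul_atTop hpa
    obtain ⟨x, hx1, hx2⟩ := ((ht.eventually_gt_atTop
      (- (y a - p a * Real.log a))).and (eventually_ge_atTop a)).exists
    have := hm2 Set.self_mem_Ici hx2 hx2
    have := hneg x hx2
    simp only at *
    linarith

theorem bP_zero_unbounded (n : ℕ) (R : ℝ) (hR : 0 < R) : ∃ ρ, R ≤ ρ ∧ bP n ρ = 0 := by
  by_contra! hne
  have hcont : ContinuousOn (bP n) (Set.Ici R) := fun x hx =>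
    (bP_hasDerivAt n (hR.trans_le hx)).continuousAt.continuousWithinAt
  have hivt : ∀ u v, R ≤ u → R ≤ v → bP n u < 0 → 0 < bP n v → False := by
    intro u v hu hv h1 h2
    obtain ⟨w, hw, hw0⟩ := (isPreconnected_Ici (a := R)).intermediate_value hu hv hcont
      (show (0 : ℝ) ∈ Set.Icc (bP n u) (bP n v) from ⟨h1.le, h2.le⟩)
    exact hne w hw hw0
  rcases lt_or_gt_of_ne (hne R le_rfl) with h | h
  · refine osc ((n : ℝ) ^ 2) (by positivity) (fun x => - besselJ n x) (fun x => - bP n x)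
      (fun ρ hρ => ?_) (fun ρ hρ => ?_) R (fun ρ hρ => ?_)
    · have h : HasDerivAt (fun x => - besselJ n x) _ ρ := (besselJ_hasDerivAt n hρ).neg
      convert h using 1; ring
    · have h : HasDerivAt (fun x => - bP n x) _ ρ := (bP_hasDerivAt n hρ).neg
      convert h using 1; ring
    · rcases lt_or_gt_of_ne (hne ρ hρ) with h' | h'
      · linarith
      · exact (hivt R ρ le_rfl hρ h h').elim
  · refine osc ((n : ℝ) ^ 2) (by positivity) (besselJ n) (bP n)
      (fun ρ hρ => besselJ_hasDerivAt n hρ) (fun ρ hρ => bP_hasDerivAt n hρ) R (fun ρ hρ => ?_)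
    rcases lt_or_gt_of_ne (hne ρ hρ) with h' | h'
    · exact (hivt ρ R hρ le_rfl h' h).elim
    · exact h'

theorem besselJ_analytic (n : ℕ) : AnalyticOnNhd ℝ (besselJ n) Set.univ := by
  rw [besselJ_eq]
  intro x _
  have h1 : AnalyticAt ℝ (fun ρ : ℝ => (ρ / 2) ^ n) x := by fun_prop (disch := norm_num)
  have h2 : AnalyticAt ℝ (fun ρ : ℝ => ρ ^ 2 / 4) x := by fun_prop (disch := norm_num)
  exact h1.mul ((bG_analytic n _ trivial).comp h2)

theorem bP_not_zero (n : ℕ) : ¬ ∀ ρ, 0 < ρ → bP n ρ = 0 := by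
  intro h0
  have hJ : ∀ ρ : ℝ, 0 < ρ → ρ ≠ n → besselJ n ρ = 0 := by
    intro ρ hρ hn
    have h1 := bP_hasDerivAt n hρ
    have h2 : HasDerivAt (bP n) 0 ρ := by
      refine (hasDerivAt_const ρ (0 : ℝ)).congr_of_eventuallyEq ?_
      filter_upwards [lt_mem_nhds hρ] with x hx using h0 x hx
    have h3 := h1.unique h2
    rw [div_eq_zero_iff, mul_eq_zero] at h3
    rcases h3 with (h3 | h3) | h3
    · exfalso
      apply hn
      have : (ρ - n) * (ρ + n) = 0 := by linarith
      rcases mul_eq_zero.1 this with h | h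
      · linarith
      · have : (0 : ℝ) ≤ n := by positivity
        linarith
    · exact h3
    · exact absurd h3 hρ.ne'
  have hG : ∀ᶠ ρ in 𝓝[>] (0 : ℝ), bG n (ρ ^ 2 / 4) = 0 := by
    have : ∀ᶠ ρ in 𝓝[>] (0 : ℝ), ρ ≠ (n : ℝ) := by
      rcases Nat.eq_zero_or_pos n with h | h
      · filter_upwards [self_mem_nhdsWithin] with x hx
        have hx' : 0 < x := hx
        subst h; simpa using hx'.ne'
      · have : (0 : ℝ) < n := by exact_mod_cast h
        filter_upwards [mem_nhdsWithin_of_mem_nhds (gt_mem_nhds this)] with x hx using ne_of_lt hx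
    filter_upwards [this, self_mem_nhdsWithin] with x hx hx0
    have hx0' : 0 < x := hx0
    have := hJ x hx0' hx
    rw [besselJ_eq] at this
    rcases mul_eq_zero.1 this with h | h
    · exact absurd h (by positivity)
    · exact h
  have hc : Continuous (fun ρ : ℝ => bG n (ρ ^ 2 / 4)) := by
    have : Continuous (bG n) :=
      continuous_iff_continuousAt.2 fun x => (bG_hasDerivAt n x).continuousAt
    exact this.comp (by fun_prop)
  have ht : Tendsto (fun ρ : ℝ => bG n (ρ ^ 2 / 4)) (𝓝[>] 0) (𝓝 (bG n (0 ^ 2 / 4))) :=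
    (hc.tendsto 0).mono_left nhdsWithin_le_nhds
  have ht0 : Tendsto (fun ρ : ℝ => bG n (ρ ^ 2 / 4)) (𝓝[>] 0) (𝓝 0) :=
    tendsto_const_nhds.congr' (hG.mono fun x hx => hx.symm)
  have h := tendsto_nhds_unique ht ht0
  have hv : bG n (0 ^ 2 / 4) = bC n 0 := by
    unfold bG
    rw [tsum_eq_single 0]
    · simp
    · intro m hm; simp [hm]
  rw [hv] at h
  unfold bC at h
  have : ((n + 0).factorial : ℝ) ≠ 0 := by exact_mod_cast (Nat.factorial_pos _).ne'
  simp at h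
  exact this (by simpa using h)

theorem deriv_zero_iff (n : ℕ) {ρ : ℝ} (hρ : 0 < ρ) :
    deriv (besselJ n) ρ = 0 ↔ bP n ρ = 0 := by
  rw [(besselJ_hasDerivAt n hρ).deriv]
  simp [hρ.ne']

theorem zeros_finite (n : ℕ) (R : ℝ) :
    ({ρ : ℝ | 0 < ρ ∧ deriv (besselJ n) ρ = 0} ∩ Set.Iic R).Finite := by
  by_contra hinf
  obtain ⟨x, _, hx⟩ := Set.Infinite.exists_accPt_of_subset_isCompact hinf
    (isCompact_Icc (a := (0 : ℝ)) (b := R)) (fun t ht => ⟨ht.1.1.le, ht.2⟩)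
  rw [accPt_iff_frequently_nhdsNE] at hx
  have := (besselJ_analytic n).deriv.eqOn_zero_of_preconnected_of_frequently_eq_zero
    isPreconnected_univ (Set.mem_univ x) (hx.mono fun t ht => ht.1.2)
  exact bP_not_zero n fun ρ hρ => (deriv_zero_iff n hρ).1 (this (Set.mem_univ ρ))

theorem exists_enum (S : Set ℝ) (hfin : ∀ R, (S ∩ Set.Iic R).Finite)
    (hunb : ∀ R, ∃ x ∈ S, R < x) : ∃ α : ℕ → ℝ, StrictMono α ∧ Set.range α = S := by
  classical
  let : LocallyFiniteOrder S := LocallyFiniteOrder.ofFiniteIcc fun a b => by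
    refine Set.Finite.of_finite_image ((hfin b).subset ?_) Subtype.val_injective.injOn
    rintro _ ⟨t, ht, rfl⟩
    exact ⟨t.2, ht.2⟩
  let : SuccOrder S := LinearLocallyFiniteOrder.succOrder S
  let : PredOrder S := LinearLocallyFiniteOrder.predOrder S
  have : NoMaxOrder S := ⟨fun a => by
    obtain ⟨x, hx, h⟩ := hunb a
    exact ⟨⟨x, hx⟩, h⟩⟩
  obtain ⟨x0, hx0, -⟩ := hunb 0
  obtain ⟨b, hb, hbmin⟩ := Set.exists_min_image _ id (hfin x0) ⟨x0, hx0, Set.self_mem_Iic⟩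
  let : OrderBot S :=
    { bot := ⟨b, hb.1⟩
      bot_le := fun a => by
        change b ≤ a.1
        rcases le_total a.1 x0 with h | h
        · exact hbmin a.1 ⟨a.2, h⟩
        · exact (hbmin x0 ⟨hx0, Set.self_mem_Iic⟩).trans h }
  let e : S ≃o ℕ := orderIsoNatOfLinearSuccPredArch
  refine ⟨fun k => (e.symm k : ℝ), fun i j hij => e.symm.strictMono hij, ?_⟩
  ext t
  constructor
  · rintro ⟨k, rfl⟩; exact (e.symm k).2
  · intro ht; exact ⟨e ⟨t, ht⟩, by simp⟩

/-- For every natural number `n`, the set of positive critical points of `J_n`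
(i.e. positive zeros of `J_n'`) is infinite, and these zeros can be enumerated as a
strictly increasing sequence `α_{n1} < α_{n2} < α_{n3} < ⋯`. -/
theorem besselJ_deriv_pos_zeros_infinite (n : ℕ) :
    {ρ : ℝ | 0 < ρ ∧ deriv (besselJ n) ρ = 0}.Infinite ∧
    ∃ α : ℕ → ℝ, StrictMono α ∧
      Set.range α = {ρ : ℝ | 0 < ρ ∧ deriv (besselJ n) ρ = 0} := by
  obtain ⟨α, hα, hr⟩ := exists_enum _ (zeros_finite n) (fun R => by
    obtain ⟨ρ, h1, h2⟩ := bP_zero_unbounded n (max R 0 + 1) (by positivity)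
    have h3 : 0 < ρ := lt_of_lt_of_le (by positivity) h1
    refine ⟨ρ, ⟨h3, (deriv_zero_iff n h3).2 h2⟩, ?_⟩
    have := le_max_left R 0
    linarith)
  refine ⟨?_, α, hα, hr⟩
  rw [← hr]
  exact Set.infinite_range_of_injective hα.injective
end

section
/- Let ω > 0, let B̃ : ℂ⁴ → ℂ⁴ be the diagonal linear map diag(iω, −iω, iω, −iω), and for a differentiable map U : ℂ⁴ → ℂ⁴ define (M U)(z) = (DU(z))(B̃ z) − B̃ (U(z)). For a multi-index p = (p₁, p₂, p₃, p₄) with p₁ + p₂ + p₃ + p₄ = 3 and k ∈ {1, 2, 3, 4}, the monomial map U(z) = z₁^{p₁} z₂^{p₂} z₃^{p₃} z₄^{p₄} e_k satisfies M U = 0 (identically on ℂ⁴) if and only if p₁ − p₂ + p₃ − p₄ + (−1)^k = 0. -/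
theorem aux_pow (n : ℕ) (a : ℂ) : (n : ℂ) * a ^ (n - 1) * a = n * a ^ n := by
  cases n with
  | zero => simp
  | succ m => simp [pow_succ, mul_assoc]

theorem aux_fderiv (p : Fin 4 → ℕ) (k : Fin 4) (c : ℂ) (z w : Fin 4 → ℂ)
    (hw : ∀ i : Fin 4, w i = (-1 : ℂ) ^ (i : ℕ) * c * z i) :
    fderiv ℂ (fun z : Fin 4 → ℂ => (∏ i, z i ^ p i) • (Pi.single k 1 : Fin 4 → ℂ)) z w
      = (c * ((p 0 : ℂ) - p 1 + p 2 - p 3) * ∏ i, z i ^ p i) •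
        (Pi.single k 1 : Fin 4 → ℂ) := by
  have h (i : Fin 4) : HasFDerivAt (fun z : Fin 4 → ℂ => z i ^ p i) _ z :=
    (hasFDerivAt_apply (𝕜 := ℂ) i z).pow (p i)
  have H := ((((h 0).mul (h 1)).mul (h 2)).mul (h 3)).smul_const (Pi.single k 1 : Fin 4 → ℂ)
  have e : (fun z : Fin 4 → ℂ => (∏ i, z i ^ p i) • (Pi.single k 1 : Fin 4 → ℂ)) =
      fun z => (z 0 ^ p 0 * z 1 ^ p 1 * z 2 ^ p 2 * z 3 ^ p 3) • (Pi.single k 1 : Fin 4 → ℂ) := by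
    funext z
    rw [Fin.prod_univ_four]
  have H' := congrArg (fun L => L w) H.fderiv
  rw [e]
  refine Eq.trans H' ?_
  have h0 := hw 0
  have h1 := hw 1
  have h2 := hw 2
  have h3 := hw 3
  simp at h0 h1 h2 h3
  simp only [ContinuousLinearMap.smulRight_apply]
  congr 1
  simp [h0, h1, h2, h3, Fin.prod_univ_four]
  have q0 := aux_pow (p 0) (z 0)
  have q1 := aux_pow (p 1) (z 1)
  have q2 := aux_pow (p 2) (z 2)
  have q3 := aux_pow (p 3) (z 3)
  linear_combination (c * z 1 ^ p 1 * z 2 ^ p 2 * z 3 ^ p 3) * q0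
    - (c * z 0 ^ p 0 * z 2 ^ p 2 * z 3 ^ p 3) * q1
    + (c * z 0 ^ p 0 * z 1 ^ p 1 * z 3 ^ p 3) * q2
    - (c * z 0 ^ p 0 * z 1 ^ p 1 * z 2 ^ p 2) * q3

/-- Kernel of the homological operator on cubic monomials: for the diagonal map
`B̃ = diag(iω, −iω, iω, −iω)` on `ℂ⁴` and a cubic monomial `U(z) = z^p e_k`
(`|p| = 3`), one has `M U ≡ 0` iff `p₁ − p₂ + p₃ − p₄ + (−1)^k = 0`.
Here `k : Fin 4` corresponds to the index `k+1 ∈ {1,2,3,4}` of the statement. -/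
theorem homological_operator_kernel_cubic (ω : ℝ) (hω : 0 < ω)
    (B : (Fin 4 → ℂ) → (Fin 4 → ℂ))
    (hB : ∀ z : Fin 4 → ℂ, ∀ i : Fin 4,
      B z i = (-1 : ℂ) ^ (i : ℕ) * (Complex.I * ω) * z i)
    (p : Fin 4 → ℕ) (hp : p 0 + p 1 + p 2 + p 3 = 3) (k : Fin 4)
    (U : (Fin 4 → ℂ) → (Fin 4 → ℂ))
    (hU : ∀ z : Fin 4 → ℂ, U z = (∏ i, z i ^ p i) • (Pi.single k 1 : Fin 4 → ℂ)) :
    (∀ z : Fin 4 → ℂ, fderiv ℂ U z (B z) - B (U z) = 0) ↔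
      (p 0 : ℤ) - (p 1 : ℤ) + (p 2 : ℤ) - (p 3 : ℤ) + (-1 : ℤ) ^ ((k : ℕ) + 1) = 0 := by
  have hc : Complex.I * (ω : ℂ) ≠ 0 :=
    mul_ne_zero Complex.I_ne_zero (by exact_mod_cast hω.ne')
  have key : ∀ z, fderiv ℂ U z (B z) - B (U z) =
      ((Complex.I * ω) * (((p 0 : ℤ) - (p 1 : ℤ) + (p 2 : ℤ) - (p 3 : ℤ)
        + (-1 : ℤ) ^ ((k : ℕ) + 1) : ℤ) : ℂ) * ∏ i, z i ^ p i) •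
        (Pi.single k 1 : Fin 4 → ℂ) := by
    intro z
    have hUe : U = fun z => (∏ i, z i ^ p i) • (Pi.single k 1 : Fin 4 → ℂ) := funext hU
    have h1 := aux_fderiv p k (Complex.I * ω) z (B z) (hB z)
    rw [← hUe] at h1
    rw [h1]
    funext j
    rw [Pi.sub_apply, hB, hU]
    by_cases hj : j = k
    · subst hj
      simp only [Pi.smul_apply, Pi.single_eq_same, smul_eq_mul]
      push_cast
      ring
    · simp [hj]
  constructor
  · intro h
    have h1 := congrFun ((key (fun _ => 1)).symm.trans (h _)) k
    simp only [Pi.smul_apply, Pi.single_eq_same, smul_eq_mul, one_pow, Finset.prod_const_one,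
      mul_one, Pi.zero_apply] at h1
    exact_mod_cast (mul_eq_zero.mp h1).resolve_left hc
  · intro h z
    rw [key z, h]
    simp
end

section
/- Let a₁, a₂, a₃, μ ∈ ℝ with a₁μ < 0. Then there exists δ > 0 such that every differentiable solution ρ = (ρ₁, ρ₂) : [0, ∞) → ℝ² of the system ρ₁' = (a₁μ + a₂ρ₁² + a₃ρ₂²)ρ₁, ρ₂' = (a₁μ + a₂ρ₂² + a₃ρ₁²)ρ₂ with ‖ρ(0)‖ ≤ δ satisfies ‖ρ(t)‖ ≤ ‖ρ(0)‖ · e^{(a₁μ/2) t} for all t ≥ 0; in particular ρ(t) → (0,0) as t → ∞, so the origin is asymptotically stable. -/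
open Filter

lemma amp_aux (c a2 a3 K s : ℝ) (hc : c < 0) (hK : K = |a2| + |a3|) (ρ1 ρ2 : ℝ → ℝ)
    (h1 : ∀ t ∈ Set.Ici (0 : ℝ),
          HasDerivWithinAt ρ1 ((c + a2 * (ρ1 t) ^ 2 + a3 * (ρ2 t) ^ 2) * ρ1 t)
            (Set.Ici (0 : ℝ)) t)
    (h2 : ∀ t ∈ Set.Ici (0 : ℝ),
          HasDerivWithinAt ρ2 ((c + a2 * (ρ2 t) ^ 2 + a3 * (ρ1 t) ^ 2) * ρ2 t)
            (Set.Ici (0 : ℝ)) t)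
    (hs0 : (ρ1 0) ^ 2 + (ρ2 0) ^ 2 < s) (hs : 2 * K * s < -c) (T : ℝ) (hT : 0 ≤ T) :
    (ρ1 T) ^ 2 + (ρ2 T) ^ 2 ≤ s * Real.exp (c * T) := by
  have hspos : 0 < s := lt_of_le_of_lt (by positivity) hs0
  have hK0 : 0 ≤ K := by rw [hK]; positivity
  have hd : ∀ t ∈ Set.Ici (0 : ℝ), HasDerivWithinAt (fun t => (ρ1 t) ^ 2 + (ρ2 t) ^ 2)
      (2 * (c * (ρ1 t ^ 2 + ρ2 t ^ 2) + a2 * ((ρ1 t ^ 2) ^ 2 + (ρ2 t ^ 2) ^ 2)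
        + 2 * a3 * (ρ1 t ^ 2 * ρ2 t ^ 2))) (Set.Ici (0 : ℝ)) t := by
    intro t ht
    have := ((h1 t ht).pow 2).add ((h2 t ht).pow 2)
    refine this.congr_deriv ?_
    push_cast
    ring
  have hB : ∀ x : ℝ, HasDerivAt (fun x => s * Real.exp (c * x)) (s * Real.exp (c * x) * c) x := by
    intro x
    have := (((hasDerivAt_id x).const_mul c).exp).const_mul s
    refine this.congr_deriv ?_
    simp
    ring
  refine image_le_of_deriv_right_lt_deriv_boundary (a := 0) (b := T)
    (f := fun t => (ρ1 t) ^ 2 + (ρ2 t) ^ 2)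
    (fun t ht => ((hd t ht.1).continuousWithinAt).mono (fun x hx => hx.1))
    (fun t ht => (hd t ht.1).mono (fun x hx => le_trans ht.1 hx)) ?_ hB ?_ ⟨hT, le_rfl⟩
  · simpa using hs0.le
  · intro x hx heq
    have heq' : ρ1 x ^ 2 + ρ2 x ^ 2 = s * Real.exp (c * x) := heq
    have he : Real.exp (c * x) ≤ 1 := by
      rw [Real.exp_le_one_iff]; exact mul_nonpos_of_nonpos_of_nonneg hc.le hx.1
    have hbp : 0 < s * Real.exp (c * x) := by positivity
    have hbs : s * Real.exp (c * x) ≤ s := mul_le_of_le_one_right hspos.le he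
    rw [← heq'] at hbp hbs ⊢
    have hu : 0 ≤ ρ1 x ^ 2 := sq_nonneg _
    have hv : 0 ≤ ρ2 x ^ 2 := sq_nonneg _
    generalize ρ1 x ^ 2 = u at *
    generalize ρ2 x ^ 2 = v at *
    have e1 : a2 * (u ^ 2 + v ^ 2) ≤ |a2| * (u + v) ^ 2 := by
      refine (mul_le_mul_of_nonneg_right (le_abs_self a2) (by positivity)).trans ?_
      exact mul_le_mul_of_nonneg_left (by nlinarith [mul_nonneg hu hv]) (abs_nonneg _)
    have e2 : a3 * (2 * (u * v)) ≤ |a3| * (u + v) ^ 2 := by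
      refine (mul_le_mul_of_nonneg_right (le_abs_self a3) (by positivity)).trans ?_
      exact mul_le_mul_of_nonneg_left (by nlinarith [mul_nonneg hu hv]) (abs_nonneg _)
    have e3 : 2 * K * (u + v) < -c :=
      (mul_le_mul_of_nonneg_left hbs (by positivity)).trans_lt hs
    have e4 := mul_lt_mul_of_pos_left e3 hbp
    rw [hK] at e4
    nlinarith

/-- Asymptotic stability of the origin for the planar amplitude system of the
O(2)-equivariant Hopf normal form when `a₁μ < 0`: small solutions decay like
`e^{(a₁μ/2)t}` and tend to the origin. -/
theorem amplitude_system_origin_asymptotically_stable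
    (a1 a2 a3 μ : ℝ) (h : a1 * μ < 0) :
    ∃ δ : ℝ, 0 < δ ∧
      ∀ ρ1 ρ2 : ℝ → ℝ,
        (∀ t ∈ Set.Ici (0 : ℝ),
          HasDerivWithinAt ρ1 ((a1 * μ + a2 * (ρ1 t) ^ 2 + a3 * (ρ2 t) ^ 2) * ρ1 t)
            (Set.Ici (0 : ℝ)) t) →
        (∀ t ∈ Set.Ici (0 : ℝ),
          HasDerivWithinAt ρ2 ((a1 * μ + a2 * (ρ2 t) ^ 2 + a3 * (ρ1 t) ^ 2) * ρ2 t)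
            (Set.Ici (0 : ℝ)) t) →
        Real.sqrt ((ρ1 0) ^ 2 + (ρ2 0) ^ 2) ≤ δ →
        ((∀ t ∈ Set.Ici (0 : ℝ),
            Real.sqrt ((ρ1 t) ^ 2 + (ρ2 t) ^ 2)
              ≤ Real.sqrt ((ρ1 0) ^ 2 + (ρ2 0) ^ 2) * Real.exp ((a1 * μ / 2) * t)) ∧
          Tendsto (fun t : ℝ => (ρ1 t, ρ2 t)) atTop (nhds ((0 : ℝ), (0 : ℝ)))) := by
  obtain ⟨K, hK⟩ : ∃ K, K = |a2| + |a3| := ⟨_, rfl⟩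
  have hK0 : 0 ≤ K := by rw [hK]; positivity
  have hD : 0 < -(a1 * μ) / (2 * (K + 1)) := div_pos (by linarith) (by positivity)
  have hKD : -(a1 * μ) / (2 * (K + 1)) * (2 * (K + 1)) = -(a1 * μ) :=
    div_mul_cancel₀ _ (by positivity)
  generalize -(a1 * μ) / (2 * (K + 1)) = D at hD hKD
  refine ⟨Real.sqrt (D / 2), by positivity, ?_⟩
  intro ρ1 ρ2 h1 h2 h0
  have h0' : ρ1 0 ^ 2 + ρ2 0 ^ 2 ≤ D / 2 := (Real.sqrt_le_sqrt_iff (by positivity)).1 h0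
  have hlt : ρ1 0 ^ 2 + ρ2 0 ^ 2 < D := by linarith
  have key : ∀ t ∈ Set.Ici (0 : ℝ), (ρ1 t) ^ 2 + (ρ2 t) ^ 2
      ≤ ((ρ1 0) ^ 2 + (ρ2 0) ^ 2) * Real.exp (a1 * μ * t) := by
    intro t ht
    have hcont : Tendsto (fun s : ℝ => s * Real.exp (a1 * μ * t))
        (nhdsWithin (ρ1 0 ^ 2 + ρ2 0 ^ 2) (Set.Ioi (ρ1 0 ^ 2 + ρ2 0 ^ 2)))
        (nhds ((ρ1 0 ^ 2 + ρ2 0 ^ 2) * Real.exp (a1 * μ * t))) :=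
      ((continuous_id.mul continuous_const).tendsto _).mono_left nhdsWithin_le_nhds
    refine ge_of_tendsto hcont ?_
    filter_upwards [Ioo_mem_nhdsGT hlt] with s hs
    refine amp_aux (a1 * μ) a2 a3 K s h hK ρ1 ρ2 h1 h2 hs.1 ?_ t ht
    have := mul_le_mul_of_nonneg_left hs.2.le hK0
    nlinarith
  have main : ∀ t ∈ Set.Ici (0 : ℝ),
            Real.sqrt ((ρ1 t) ^ 2 + (ρ2 t) ^ 2)
              ≤ Real.sqrt ((ρ1 0) ^ 2 + (ρ2 0) ^ 2) * Real.exp ((a1 * μ / 2) * t) := by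
    intro t ht
    refine (Real.sqrt_le_sqrt (key t ht)).trans_eq ?_
    rw [Real.sqrt_mul (by positivity), ← Real.exp_half]
    congr 2
    ring
  refine ⟨main, ?_⟩
  have hlim : Tendsto (fun t : ℝ => Real.sqrt ((ρ1 0) ^ 2 + (ρ2 0) ^ 2)
      * Real.exp ((a1 * μ / 2) * t)) atTop (nhds 0) := by
    have : Tendsto (fun t : ℝ => (a1 * μ / 2) * t) atTop atBot :=
      tendsto_id.const_mul_atTop_of_neg (by linarith)
    simpa using (Real.tendsto_exp_atBot.comp this).const_mul
      (Real.sqrt ((ρ1 0) ^ 2 + (ρ2 0) ^ 2))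
  refine Tendsto.prodMk_nhds ?_ ?_
  · refine squeeze_zero_norm' ?_ hlim
    filter_upwards [eventually_ge_atTop 0] with t ht
    refine le_trans ?_ (main t ht)
    exact Real.abs_le_sqrt (by nlinarith [sq_nonneg (ρ2 t)])
  · refine squeeze_zero_norm' ?_ hlim
    filter_upwards [eventually_ge_atTop 0] with t ht
    refine le_trans ?_ (main t ht)
    exact Real.abs_le_sqrt (by nlinarith [sq_nonneg (ρ1 t)])
end

section
/- Let a₁, a₂, a₃, μ ∈ ℝ with a₁μ > 0, a₂ < 0 and a₂ − a₃ > 0, and set ρ̂ = √(−a₁μ/a₂). Then the equilibrium (ρ̂, 0) of the planar amplitude system (which corresponds to the rotating-wave periodic solution of the equivariant Hopf bifurcation) is locally asymptotically stable: there exists δ > 0 such that every differentiable solution ρ : [0, ∞) → ℝ² of ρ₁' = (a₁μ + a₂ρ₁² + a₃ρ₂²)ρ₁, ρ₂' = (a₁μ + a₂ρ₂² + a₃ρ₁²)ρ₂ with ‖ρ(0) − (ρ̂, 0)‖ ≤ δ satisfies ρ(t) → (ρ̂, 0) as t → ∞. -/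
open Filter

/-- Local asymptotic stability of the rotating-wave equilibrium `(ρ̂, 0)`,
`ρ̂ = √(−a₁μ/a₂)`, of the planar amplitude system when `a₁μ > 0`, `a₂ < 0` and
`a₂ − a₃ > 0`: every solution starting close enough to `(ρ̂, 0)` converges to it. -/
theorem amplitude_system_rotating_wave_stable
    (a1 a2 a3 μ : ℝ) (h1 : 0 < a1 * μ) (h2 : a2 < 0) (h3 : 0 < a2 - a3)
    (ρhat : ℝ) (hρ : ρhat = Real.sqrt (-(a1 * μ) / a2)) :
    ∃ δ : ℝ, 0 < δ ∧
      ∀ ρ1 ρ2 : ℝ → ℝ,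
        (∀ t ∈ Set.Ici (0 : ℝ),
          HasDerivWithinAt ρ1 ((a1 * μ + a2 * (ρ1 t) ^ 2 + a3 * (ρ2 t) ^ 2) * ρ1 t)
            (Set.Ici (0 : ℝ)) t) →
        (∀ t ∈ Set.Ici (0 : ℝ),
          HasDerivWithinAt ρ2 ((a1 * μ + a2 * (ρ2 t) ^ 2 + a3 * (ρ1 t) ^ 2) * ρ2 t)
            (Set.Ici (0 : ℝ)) t) →
        Real.sqrt ((ρ1 0 - ρhat) ^ 2 + (ρ2 0) ^ 2) ≤ δ →
        Tendsto (fun t : ℝ => (ρ1 t, ρ2 t)) atTop (nhds (ρhat, (0 : ℝ))) := by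
  have hq : 0 < -(a1 * μ) / a2 := div_pos_of_neg_of_neg (by linarith) h2
  have hr : 0 < ρhat := by rw [hρ]; exact Real.sqrt_pos.mpr hq
  have hm : a1 * μ = -a2 * ρhat ^ 2 := by
    have h2n := h2.ne
    rw [hρ, Real.sq_sqrt hq.le]; field_simp
  clear hρ hq
  generalize a1 * μ = m at *
  generalize ρhat = r at *
  subst hm
  have ha3 : 0 < -a3 := by linarith
  obtain ⟨δ, hδ, hδ1, hδ2⟩ : ∃ δ : ℝ, 0 < δ ∧ δ ≤ r / 2 ∧ 6 * (-a3) * δ ≤ (a2 - a3) * r := by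
    refine ⟨min (r / 2) ((a2 - a3) * r / (6 * (-a3))), by positivity, min_le_left _ _, ?_⟩
    have := min_le_right (r / 2) ((a2 - a3) * r / (6 * (-a3)))
    rw [le_div_iff₀ (by positivity)] at this
    linarith
  obtain ⟨c, hc, hc1, hc2⟩ : ∃ c : ℝ, 0 < c ∧ 2 * c ≤ -a2 * r ^ 2 ∧ 2 * c ≤ (a2 - a3) * r ^ 2 := by
    have h2' : 0 < -a2 := by linarith
    refine ⟨min (-a2 * r ^ 2) ((a2 - a3) * r ^ 2) / 2, by positivity, ?_, ?_⟩
    · linarith [min_le_left (-a2 * r ^ 2) ((a2 - a3) * r ^ 2)]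
    · linarith [min_le_right (-a2 * r ^ 2) ((a2 - a3) * r ^ 2)]
  refine ⟨δ, hδ, fun ρ1 ρ2 hd1 hd2 h0 => ?_⟩
  have h0' : (ρ1 0 - r) ^ 2 + (ρ2 0) ^ 2 ≤ δ ^ 2 := (Real.sqrt_le_left hδ.le).mp h0
  have key : ∀ x y : ℝ, (x - r) ^ 2 + y ^ 2 ≤ δ ^ 2 →
      2 * (x - r) * ((-a2 * r ^ 2 + a2 * x ^ 2 + a3 * y ^ 2) * x)
        + 2 * y * ((-a2 * r ^ 2 + a2 * y ^ 2 + a3 * x ^ 2) * y)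
        ≤ -(2 * c) * ((x - r) ^ 2 + y ^ 2) := by
    intro x y h
    obtain ⟨u, rfl⟩ : ∃ u, x = u + r := ⟨x - r, by ring⟩
    rw [add_sub_cancel_right] at *
    have hu : |u| ≤ δ := abs_le_of_sq_le_sq (by nlinarith [sq_nonneg y]) hδ.le
    obtain ⟨hu1, hu2⟩ := abs_le.mp hu
    have e1 : r ^ 2 / 2 ≤ (u + 2 * r) * (u + r) := by nlinarith
    have e2 : a2 * ((u + 2 * r) * (u + r)) ≤ -c := by nlinarith
    have e3 : 3 * (-a3) * (-u) * r ≤ 3 * (-a3) * δ * r := by gcongr; linarith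
    have e4 : 6 * (-a3) * δ * r ≤ (a2 - a3) * r * r := by gcongr
    have e5 : (a3 - a2) * r ^ 2 + a2 * y ^ 2 + 2 * a3 * u ^ 2 + 3 * a3 * r * u ≤ -c := by
      nlinarith [mul_nonneg ha3.le (sq_nonneg u), mul_nonneg (neg_pos.mpr h2).le (sq_nonneg y)]
    nlinarith [mul_le_mul_of_nonneg_right e2 (sq_nonneg u),
      mul_le_mul_of_nonneg_right e5 (sq_nonneg y)]
  have hW : ∀ t ∈ Set.Ici (0 : ℝ), HasDerivWithinAt (fun t => (ρ1 t - r) ^ 2 + (ρ2 t) ^ 2)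
      (2 * (ρ1 t - r) * ((-a2 * r ^ 2 + a2 * ρ1 t ^ 2 + a3 * ρ2 t ^ 2) * ρ1 t)
        + 2 * ρ2 t * ((-a2 * r ^ 2 + a2 * ρ2 t ^ 2 + a3 * ρ1 t ^ 2) * ρ2 t))
      (Set.Ici 0) t := by
    intro t ht
    have := (((hd1 t ht).sub_const r).pow 2).add ((hd2 t ht).pow 2)
    refine this.congr_deriv ?_
    push_cast; ring
  have hB : ∀ t : ℝ, HasDerivAt (fun t => δ ^ 2 * Real.exp (-c * t))
      (-c * (δ ^ 2 * Real.exp (-c * t))) t := by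
    intro t
    have := (((hasDerivAt_id t).const_mul (-c)).exp).const_mul (δ ^ 2)
    refine this.congr_deriv ?_
    simp only [id]; ring
  have bound : ∀ T : ℝ, 0 ≤ T → (ρ1 T - r) ^ 2 + (ρ2 T) ^ 2 ≤ δ ^ 2 * Real.exp (-c * T) := by
    intro T hT
    refine image_le_of_deriv_right_lt_deriv_boundary
      (f := fun t => (ρ1 t - r) ^ 2 + (ρ2 t) ^ 2) (a := 0) (b := T)
      (fun t ht => ((hW t ht.1).continuousWithinAt).mono Set.Icc_subset_Ici_self)
      (fun t ht => (hW t ht.1).mono (Set.Ici_subset_Ici.mpr ht.1))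
      (by simpa using h0') hB ?_ ⟨hT, le_refl T⟩
    intro t ht he
    have hE : Real.exp (-c * t) ≤ 1 := Real.exp_le_one_iff.mpr (by nlinarith [ht.1])
    have hp : 0 < δ ^ 2 * Real.exp (-c * t) := by positivity
    have hle : (ρ1 t - r) ^ 2 + (ρ2 t) ^ 2 ≤ δ ^ 2 := by
      rw [he]; exact mul_le_of_le_one_right (by positivity) hE
    refine (key _ _ hle).trans_lt ?_
    rw [he]
    nlinarith [mul_pos hc hp]
  have hlim : Tendsto (fun t : ℝ => δ ^ 2 * Real.exp (-c * t)) atTop (nhds 0) := by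
    have h : Tendsto (fun t : ℝ => -c * t) atTop atBot :=
      tendsto_id.const_mul_atTop_of_neg (by linarith)
    simpa using (Real.tendsto_exp_atBot.comp h).const_mul (δ ^ 2)
  have hs : Tendsto (fun t : ℝ => Real.sqrt (δ ^ 2 * Real.exp (-c * t))) atTop (nhds 0) := by
    simpa using hlim.sqrt
  refine Tendsto.prodMk_nhds ?_ ?_
  · rw [tendsto_iff_dist_tendsto_zero]
    refine squeeze_zero' (Eventually.of_forall fun t => dist_nonneg) ?_ hs
    filter_upwards [eventually_ge_atTop 0] with t ht
    rw [Real.dist_eq]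
    exact Real.abs_le_sqrt (by nlinarith [bound t ht, sq_nonneg (ρ2 t)])
  · rw [tendsto_iff_dist_tendsto_zero]
    refine squeeze_zero' (Eventually.of_forall fun t => dist_nonneg) ?_ hs
    filter_upwards [eventually_ge_atTop 0] with t ht
    rw [Real.dist_eq, sub_zero]
    exact Real.abs_le_sqrt (by nlinarith [bound t ht, sq_nonneg (ρ1 t - r)])
end

section
/- Let a₁, a₂, a₃, μ ∈ ℝ with a₁μ > 0, a₂ + a₃ < 0 and a₂ − a₃ < 0, and set ρ* = √(−a₁μ/(a₂ + a₃)). Then the diagonal equilibrium (ρ*, ρ*) of the planar amplitude system (which corresponds to the standing-wave periodic solution of the equivariant Hopf bifurcation) is locally asymptotically stable: there exists δ > 0 such that every differentiable solution ρ : [0, ∞) → ℝ² of ρ₁' = (a₁μ + a₂ρ₁² + a₃ρ₂²)ρ₁, ρ₂' = (a₁μ + a₂ρ₂² + a₃ρ₁²)ρ₂ with ‖ρ(0) − (ρ*, ρ*)‖ ≤ δ satisfies ρ(t) → (ρ*, ρ*) as t → ∞. -/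
open Filter

lemma cubic_bound (a2 a3 r e u v c M : ℝ) (hr : 0 < r) (he : 0 < e) (her : e ≤ r)
    (hM : M = |a2| + |a3|) (hc : c = -(a2 + |a3|)) (hcp : 0 < c)
    (hec : 8 * (e * (M + 1)) ≤ r * c) (hV : u ^ 2 + v ^ 2 ≤ e ^ 2) :
    2 * u * ((a2 * (u * (u + 2 * r)) + a3 * (v * (v + 2 * r))) * (r + u))
      + 2 * v * ((a2 * (v * (v + 2 * r)) + a3 * (u * (u + 2 * r))) * (r + v))
      ≤ -(2 * r ^ 2 * c) * (u ^ 2 + v ^ 2) := by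
  have key : ∀ x y : ℝ, x ^ 2 + y ^ 2 ≤ e ^ 2 →
      x * (r * (a2 * x ^ 2 + a3 * y ^ 2) + 2 * r * (a2 * x ^ 2 + a3 * (x * y))
        + x * (a2 * x ^ 2 + a3 * y ^ 2)) ≤ e * (4 * r * M * (x ^ 2 + y ^ 2)) := by
    intro x y h
    have hx : |x| ≤ e := abs_le_of_sq_le_sq (by nlinarith [sq_nonneg y]) he.le
    have hMn : 0 ≤ M := by rw [hM]; positivity
    have hb1 : |a2 * x ^ 2 + a3 * y ^ 2| ≤ M * (x ^ 2 + y ^ 2) := by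
      refine (abs_add_le _ _).trans ?_
      rw [abs_mul, abs_mul, abs_of_nonneg (sq_nonneg x), abs_of_nonneg (sq_nonneg y), hM]
      nlinarith [mul_nonneg (abs_nonneg a2) (sq_nonneg y), mul_nonneg (abs_nonneg a3) (sq_nonneg x)]
    have hxy : |x * y| ≤ x ^ 2 + y ^ 2 := by
      rw [abs_le]; constructor <;> nlinarith [sq_nonneg (x + y), sq_nonneg (x - y), sq_nonneg x, sq_nonneg y]
    have hb2 : |a2 * x ^ 2 + a3 * (x * y)| ≤ M * (x ^ 2 + y ^ 2) := by
      refine (abs_add_le _ _).trans ?_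
      rw [abs_mul, abs_mul a3, abs_of_nonneg (sq_nonneg x), hM]
      nlinarith [mul_nonneg (abs_nonneg a2) (sq_nonneg y),
        mul_le_mul_of_nonneg_left hxy (abs_nonneg a3)]
    have hW : 0 ≤ M * (x ^ 2 + y ^ 2) := by positivity
    have hb3 : |x * (a2 * x ^ 2 + a3 * y ^ 2)| ≤ r * (M * (x ^ 2 + y ^ 2)) := by
      rw [abs_mul]
      exact mul_le_mul (hx.trans her) hb1 (abs_nonneg _) hr.le
    have hb : |r * (a2 * x ^ 2 + a3 * y ^ 2) + 2 * r * (a2 * x ^ 2 + a3 * (x * y))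
        + x * (a2 * x ^ 2 + a3 * y ^ 2)| ≤ 4 * r * M * (x ^ 2 + y ^ 2) := by
      have e1 := mul_le_mul_of_nonneg_left (abs_le.1 hb1).1 hr.le
      have e2 := mul_le_mul_of_nonneg_left (abs_le.1 hb1).2 hr.le
      have e3 := mul_le_mul_of_nonneg_left (abs_le.1 hb2).1 hr.le
      have e4 := mul_le_mul_of_nonneg_left (abs_le.1 hb2).2 hr.le
      have e5 := abs_le.1 hb3
      rw [abs_le]; constructor <;> linarith [e5.1, e5.2]
    refine (le_abs_self _).trans ?_
    rw [abs_mul]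
    exact mul_le_mul hx hb (abs_nonneg _) he.le
  have k1 := key u v hV
  have k2 := key v u (by linarith)
  have hlin : a2 * (u ^ 2 + v ^ 2) + 2 * a3 * (u * v) ≤ -c * (u ^ 2 + v ^ 2) := by
    rw [hc]
    nlinarith [mul_nonneg (sub_nonneg.2 (le_abs_self a3)) (sq_nonneg (u + v)),
      mul_nonneg (sub_nonneg.2 (neg_abs_le a3)) (sq_nonneg (u - v))]
  have hlin' := mul_le_mul_of_nonneg_left hlin (by positivity : 0 ≤ 4 * r ^ 2)
  have hVn : 0 ≤ u ^ 2 + v ^ 2 := by positivity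
  have hsm : e * (4 * r * M * (u ^ 2 + v ^ 2)) * 4 ≤ 2 * r ^ 2 * c * (u ^ 2 + v ^ 2) := by
    have := mul_le_mul_of_nonneg_right hec (by positivity : 0 ≤ 2 * r * (u ^ 2 + v ^ 2))
    have h0 : 0 ≤ e * r * (u ^ 2 + v ^ 2) := by positivity
    nlinarith
  nlinarith

/-- Local asymptotic stability of the standing-wave equilibrium `(ρ*, ρ*)`,
`ρ* = √(−a₁μ/(a₂+a₃))`, of the planar amplitude system when `a₁μ > 0`, `a₂ + a₃ < 0`
and `a₂ − a₃ < 0`: every solution starting close enough to `(ρ*, ρ*)` converges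
to it. -/
theorem amplitude_system_standing_wave_stable
    (a1 a2 a3 μ : ℝ) (h1 : 0 < a1 * μ) (h2 : a2 + a3 < 0) (h3 : a2 - a3 < 0)
    (ρstar : ℝ) (hρ : ρstar = Real.sqrt (-(a1 * μ) / (a2 + a3))) :
    ∃ δ : ℝ, 0 < δ ∧
      ∀ ρ1 ρ2 : ℝ → ℝ,
        (∀ t ∈ Set.Ici (0 : ℝ),
          HasDerivWithinAt ρ1 ((a1 * μ + a2 * (ρ1 t) ^ 2 + a3 * (ρ2 t) ^ 2) * ρ1 t)
            (Set.Ici (0 : ℝ)) t) →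
        (∀ t ∈ Set.Ici (0 : ℝ),
          HasDerivWithinAt ρ2 ((a1 * μ + a2 * (ρ2 t) ^ 2 + a3 * (ρ1 t) ^ 2) * ρ2 t)
            (Set.Ici (0 : ℝ)) t) →
        Real.sqrt ((ρ1 0 - ρstar) ^ 2 + (ρ2 0 - ρstar) ^ 2) ≤ δ →
        Tendsto (fun t : ℝ => (ρ1 t, ρ2 t)) atTop (nhds (ρstar, ρstar)) := by
  have hq : 0 < -(a1 * μ) / (a2 + a3) := div_pos_of_neg_of_neg (by linarith) h2
  have hr : 0 < ρstar := by rw [hρ]; exact Real.sqrt_pos.2 hq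
  have hr2 : a1 * μ = -(a2 + a3) * ρstar ^ 2 := by
    rw [hρ, Real.sq_sqrt hq.le]; field_simp [h2.ne]
  clear hρ
  obtain ⟨M, hM⟩ : ∃ M, M = |a2| + |a3| := ⟨_, rfl⟩
  obtain ⟨c, hc⟩ : ∃ c, c = -(a2 + |a3|) := ⟨_, rfl⟩
  have hcp : 0 < c := by
    rcases abs_cases a3 with h | h <;> rw [hc, h.1] <;> linarith
  have hMn : 0 ≤ M := by rw [hM]; positivity
  obtain ⟨e, he, her, hec⟩ : ∃ e, 0 < e ∧ e ≤ ρstar ∧ 8 * (e * (M + 1)) ≤ ρstar * c := by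
    refine ⟨min ρstar (ρstar * c / (8 * (M + 1))), lt_min hr (by positivity), min_le_left _ _, ?_⟩
    have := min_le_right ρstar (ρstar * c / (8 * (M + 1)))
    rw [le_div_iff₀ (by positivity)] at this
    linarith
  refine ⟨e, he, fun ρ1 ρ2 d1 d2 h0 => ?_⟩
  have h0' : (ρ1 0 - ρstar) ^ 2 + (ρ2 0 - ρstar) ^ 2 ≤ e ^ 2 := (Real.sqrt_le_left he.le).1 h0
  set k : ℝ := ρstar ^ 2 * c with hk
  have hkp : 0 < k := by positivity
  set V : ℝ → ℝ := fun t => (ρ1 t - ρstar) ^ 2 + (ρ2 t - ρstar) ^ 2 with hVdef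
  set V' : ℝ → ℝ := fun t =>
    2 * (ρ1 t - ρstar) * ((a1 * μ + a2 * (ρ1 t) ^ 2 + a3 * (ρ2 t) ^ 2) * ρ1 t)
    + 2 * (ρ2 t - ρstar) * ((a1 * μ + a2 * (ρ2 t) ^ 2 + a3 * (ρ1 t) ^ 2) * ρ2 t) with hV'def
  have hVd : ∀ t ∈ Set.Ici (0 : ℝ), HasDerivWithinAt V (V' t) (Set.Ici 0) t := by
    intro t ht
    have := (((d1 t ht).sub_const ρstar).pow 2).add (((d2 t ht).sub_const ρstar).pow 2)
    refine HasDerivWithinAt.congr_deriv (f := V) this ?_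
    simp [hV'def]
  have hV' : ∀ t, V t ≤ e ^ 2 → V' t ≤ -(2 * k) * V t := by
    intro t ht
    have := cubic_bound a2 a3 ρstar e (ρ1 t - ρstar) (ρ2 t - ρstar) c M hr he her hM hc hcp hec ht
    simp only [hV'def, hVdef, hr2, hk]
    linarith
  set B : ℝ → ℝ := fun t => e ^ 2 * Real.exp (-k * t) with hB
  have hBd : ∀ t, HasDerivAt B (-k * B t) t := by
    intro t
    have := (((hasDerivAt_id t).const_mul (-k)).exp).const_mul (e ^ 2)
    refine HasDerivAt.congr_deriv (f := B) this ?_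
    simp [hB]; ring
  have hVB : ∀ t, 0 ≤ t → V t ≤ B t := by
    intro t ht
    refine image_le_of_deriv_right_lt_deriv_boundary (f := V) (f' := V') (a := 0) (b := t)
      (B := B) (B' := fun t => -k * B t) ?_ ?_ ?_ hBd ?_ ⟨ht, le_rfl⟩
    · intro s hs
      exact ((hVd s hs.1).continuousWithinAt).mono (fun x hx => hx.1)
    · intro s hs
      exact (hVd s hs.1).mono (Set.Ici_subset_Ici.2 hs.1)
    · simpa [hB, hVdef] using h0'
    · intro s hs hsB
      have hBp : 0 < B s := by positivity
      have hle : V s ≤ e ^ 2 := by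
        rw [hsB]
        have : Real.exp (-k * s) ≤ 1 := Real.exp_le_one_iff.2 (by nlinarith [hs.1])
        simp only [hB]
        nlinarith [sq_nonneg e]
      have := hV' s hle
      rw [hsB] at this
      nlinarith [mul_pos hkp hBp]
  have hB0 : Tendsto B atTop (nhds 0) := by
    have h : Tendsto (fun t : ℝ => -k * t) atTop atBot :=
      tendsto_id.const_mul_atTop_of_neg (by linarith)
    simpa [hB] using (Real.tendsto_exp_atBot.comp h).const_mul (e ^ 2)
  have hlim : ∀ f : ℝ → ℝ, (∀ t, (f t - ρstar) ^ 2 ≤ V t) → Tendsto f atTop (nhds ρstar) := by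
    intro f hf
    have h1 : Tendsto (fun t => (f t - ρstar) ^ 2) atTop (nhds 0) := by
      refine squeeze_zero' (Eventually.of_forall fun t => sq_nonneg _) ?_ hB0
      filter_upwards [eventually_ge_atTop 0] with t ht
      exact (hf t).trans (hVB t ht)
    have h2 : Tendsto (fun t => |f t - ρstar|) atTop (nhds 0) := by
      have := h1.sqrt
      simpa [Real.sqrt_sq_eq_abs] using this
    rw [tendsto_iff_dist_tendsto_zero]
    simpa [Real.dist_eq] using h2
  exact (hlim ρ1 fun t => by simp only [hVdef]; nlinarith [sq_nonneg (ρ2 t - ρstar)]).prodMk_nhds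
    (hlim ρ2 fun t => by simp only [hVdef]; nlinarith [sq_nonneg (ρ1 t - ρstar)])
end
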